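/- Let Re > 0, 0 < ε₀ ≤ 1 and α_m ≥ 0. Let ε : ℝ^d → ℝ be continuously differentiable with ε₀ ≤ ε(x) ≤ 1 for all x, let a, b : ℝ^d → ℝ be continuous with a(x) ≥ α_m and b(x) ≥ 0 for all x, let v : ℝ^d → ℝ^d be continuously differentiable, and let w : ℝ^d → ℝ^d be continuously differentiable with compact support. Then (1/Re) ∫_{ℝ^d} ε |Dw|² dx + ∫_{ℝ^d} a |w|² dx + ∫_{ℝ^d} ε ((v·∇)w)·w dx + (1/2) ∫_{ℝ^d} div(εv) |w|² dx + ∫_{ℝ^d} b |v| |w|² dx ≥ (ε₀/Re) ∫_{ℝ^d} |Dw|² dx + α_m ∫_{ℝ^d} |w|² dx. -/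

import Mathlib

open MeasureTheory
open scoped RealInnerProductSpace

/-- Frobenius norm of a continuous linear map between Euclidean spaces. -/
noncomputable def frobNorm {d : ℕ}
    (f : EuclideanSpace ℝ (Fin d) →L[ℝ] EuclideanSpace ℝ (Fin d)) : ℝ :=
  Real.sqrt (∑ i, ∑ j, (f (EuclideanSpace.single j 1) i) ^ 2)

theorem continuous_frobNorm {d : ℕ} : Continuous (frobNorm (d := d)) := by
  unfold frobNorm
  fun_prop

/-- The divergence theorem for `φ u` on the whole space, with `φ` compactly supported. -/
theorem integral_sum_mul_fderiv_eq_neg {d : ℕ}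
    {u : Fin d → EuclideanSpace ℝ (Fin d) → ℝ} {φ : EuclideanSpace ℝ (Fin d) → ℝ}
    (hu : ∀ j, ContDiff ℝ 1 (u j)) (hφ : ContDiff ℝ 1 φ) (hφs : HasCompactSupport φ) :
    ∫ x, ∑ j, u j x * fderiv ℝ φ x (EuclideanSpace.single j 1) =
      -∫ x, (∑ j, fderiv ℝ (u j) x (EuclideanSpace.single j 1)) * φ x := by
  have hdu (j) : Continuous fun x => fderiv ℝ (u j) x (EuclideanSpace.single j 1) :=
    ((hu j).continuous_fderiv one_ne_zero).clm_apply continuous_const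
  have hdφ (j : Fin d) : Continuous fun x => fderiv ℝ φ x (EuclideanSpace.single j 1) :=
    (hφ.continuous_fderiv one_ne_zero).clm_apply continuous_const
  have h₁ (j) : Integrable fun x => fderiv ℝ (u j) x (EuclideanSpace.single j 1) * φ x :=
    ((hdu j).mul hφ.continuous).integrable_of_hasCompactSupport hφs.mul_left
  have h₂ (j) : Integrable fun x => u j x * fderiv ℝ φ x (EuclideanSpace.single j 1) :=
    ((hu j).continuous.mul (hdφ j)).integrable_of_hasCompactSupport
      (hφs.fderiv_apply ℝ _).mul_left
  have h₃ (j) : Integrable fun x => u j x * φ x :=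
    ((hu j).continuous.mul hφ.continuous).integrable_of_hasCompactSupport hφs.mul_left
  simp only [Finset.sum_mul]
  rw [integral_finsetSum _ fun j _ => h₂ j, integral_finsetSum _ fun j _ => h₁ j,
    ← Finset.sum_neg_distrib]
  exact Finset.sum_congr rfl fun j _ =>
    integral_mul_fderiv_eq_neg_fderiv_mul_of_integrable (h₁ j) (h₂ j) (h₃ j)
      (fun x _ => (hu j).differentiable one_ne_zero x)
      (fun x _ => hφ.differentiable one_ne_zero x)

/-- The stabilized convection form is skew-symmetric: it vanishes on the diagonal. -/
theorem integral_convection_add_half_integral_div_eq_zero {d : ℕ}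
    {ε : EuclideanSpace ℝ (Fin d) → ℝ}
    {v w : EuclideanSpace ℝ (Fin d) → EuclideanSpace ℝ (Fin d)}
    (hε : ContDiff ℝ 1 ε) (hv : ContDiff ℝ 1 v) (hw : ContDiff ℝ 1 w)
    (hws : HasCompactSupport w) :
    (∫ x, ε x * ⟪fderiv ℝ w x (v x), w x⟫) +
      (1 / 2) * (∫ x, (∑ j, fderiv ℝ (fun y => ε y * v y j) x
        (EuclideanSpace.single j 1)) * ‖w x‖ ^ 2) = 0 := by
  have hφs : HasCompactSupport fun x => ‖w x‖ ^ 2 :=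
    hws.comp_left (g := fun y => ‖y‖ ^ 2) (by simp)
  have hu (j) : ContDiff ℝ 1 fun y => ε y * v y j :=
    hε.mul (contDiff_euclidean.1 hv j)
  have key := integral_sum_mul_fderiv_eq_neg hu (hw.norm_sq ℝ) hφs
  have hpt (x) : ∑ j, ε x * v x j *
      fderiv ℝ (fun y => ‖w y‖ ^ 2) x (EuclideanSpace.single j 1) =
        2 * (ε x * ⟪fderiv ℝ w x (v x), w x⟫) := by
    have hsum : ∑ j, v x j • EuclideanSpace.single j (1 : ℝ) = v x := by
      simpa using (EuclideanSpace.basisFun (Fin d) ℝ).sum_repr (v x)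
    have hd := (hw.differentiable one_ne_zero x).hasFDerivAt.norm_sq
    calc _ = ε x * fderiv ℝ (fun y => ‖w y‖ ^ 2) x
          (∑ j, v x j • EuclideanSpace.single j (1 : ℝ)) := by
          simp only [map_sum, map_smul, smul_eq_mul, Finset.mul_sum, mul_assoc]
      _ = _ := by
          rw [hsum, hd.fderiv, real_inner_comm]
          simp
          ring
  simp only [hpt, integral_const_mul] at key
  linarith

/-- Coercivity of the stabilized form `a_h(w,w) + c_h(v,w,w)`:
`(1/Re) ∫ ε |Dw|² + ∫ a |w|² + ∫ ε ((v·∇)w)·w + (1/2) ∫ div(εv) |w|² + ∫ b |v| |w|²`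
is bounded below by `(ε₀/Re) ∫ |Dw|² + α_m ∫ |w|²`. -/
theorem stabilized_form_coercivity (d : ℕ) (Re ε₀ αm : ℝ)
    (hRe : 0 < Re) (hε₀ : 0 < ε₀) (hε₀1 : ε₀ ≤ 1) (hαm : 0 ≤ αm)
    (ε : EuclideanSpace ℝ (Fin d) → ℝ) (hε : ContDiff ℝ 1 ε)
    (hεl : ∀ x, ε₀ ≤ ε x) (hεu : ∀ x, ε x ≤ 1)
    (a b : EuclideanSpace ℝ (Fin d) → ℝ) (ha : Continuous a) (hb : Continuous b)
    (hal : ∀ x, αm ≤ a x) (hbl : ∀ x, 0 ≤ b x)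
    (v w : EuclideanSpace ℝ (Fin d) → EuclideanSpace ℝ (Fin d))
    (hv : ContDiff ℝ 1 v) (hw : ContDiff ℝ 1 w) (hws : HasCompactSupport w) :
    (ε₀ / Re) * (∫ x, frobNorm (fderiv ℝ w x) ^ 2) + αm * (∫ x, ‖w x‖ ^ 2) ≤
      (1 / Re) * (∫ x, ε x * frobNorm (fderiv ℝ w x) ^ 2) +
        (∫ x, a x * ‖w x‖ ^ 2) +
        (∫ x, ε x * ⟪fderiv ℝ w x (v x), w x⟫) +
        (1 / 2) * (∫ x, (∑ j, fderiv ℝ (fun y => ε y * v y j) x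
          (EuclideanSpace.single j 1)) * ‖w x‖ ^ 2) +
        ∫ x, b x * ‖v x‖ * ‖w x‖ ^ 2 := by
  have hDw : Continuous fun x => frobNorm (fderiv ℝ w x) ^ 2 :=
    (continuous_frobNorm.comp (hw.continuous_fderiv one_ne_zero)).pow 2
  have hDws : HasCompactSupport fun x => frobNorm (fderiv ℝ w x) ^ 2 :=
    (hws.fderiv ℝ).comp_left (g := fun f => frobNorm f ^ 2) (by simp [frobNorm])
  have hw2 : Continuous fun x => ‖w x‖ ^ 2 := hw.continuous.norm.pow 2
  have hw2s : HasCompactSupport fun x => ‖w x‖ ^ 2 :=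
    hws.comp_left (g := fun y => ‖y‖ ^ 2) (by simp)
  have hdiff : ε₀ * (∫ x, frobNorm (fderiv ℝ w x) ^ 2) ≤
      ∫ x, ε x * frobNorm (fderiv ℝ w x) ^ 2 := by
    rw [← integral_const_mul]
    exact integral_mono ((hDw.integrable_of_hasCompactSupport hDws).const_mul ε₀)
      ((hε.continuous.mul hDw).integrable_of_hasCompactSupport hDws.mul_left)
      fun x => mul_le_mul_of_nonneg_right (hεl x) (sq_nonneg _)
  have hreac : αm * (∫ x, ‖w x‖ ^ 2) ≤ ∫ x, a x * ‖w x‖ ^ 2 := by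
    rw [← integral_const_mul]
    exact integral_mono ((hw2.integrable_of_hasCompactSupport hw2s).const_mul αm)
      ((ha.mul hw2).integrable_of_hasCompactSupport hw2s.mul_left)
      fun x => mul_le_mul_of_nonneg_right (hal x) (sq_nonneg _)
  have hforch : 0 ≤ ∫ x, b x * ‖v x‖ * ‖w x‖ ^ 2 :=
    integral_nonneg fun x => mul_nonneg (mul_nonneg (hbl x) (norm_nonneg _)) (sq_nonneg _)
  have hconv := integral_convection_add_half_integral_div_eq_zero hε hv hw hws
  have hvisc := mul_le_mul_of_nonneg_left hdiff (one_div_pos.2 hRe).le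
  rw [← mul_assoc, one_div_mul_eq_div] at hvisc
  linarith
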